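/- arXiv:1206.0272 — 4 statements merged into one kernel-verified Lean document; each statement's English description precedes it below -/
import Mathlib

section
/- Let O ⊆ ℝ³ be open, let u : ℝ × O → ℝ be twice continuously differentiable and satisfy the energy-critical nonlinear wave equation ∂ₜ²u − Δu = −u⁵ on ℝ × O, let α : O → ℝ³ be a continuously differentiable vector field, and let M ∈ ℝ. Define Q = (t+M)(|∇u|²/2 + u⁶/6 + (∂ₜu)²/2) + (∂ₜu)(α·∇u) + u ∂ₜu, P = (|∇u|²/2 + u⁶/6 − (∂ₜu)²/2) α − ((t+M)∂ₜu + α·∇u + u) ∇u, and R = (div α − 3)(∂ₜu)²/2 + (1 − div α)|∇u|²/2 + (5 − div α) u⁶/6 + Σ_{i,j=1}^{3} (∂ᵢα_j)(∂ᵢu)(∂_j u). Then the divergence identity ∂ₜQ + div P + R = 0 holds at every point (t,x) ∈ ℝ × O. -/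
/-- Time partial derivative of `u : ℝ × ℝ³ → ℝ` at `p = (t,x)`. -/
noncomputable def ptDeriv (u : ℝ × (Fin 3 → ℝ) → ℝ) (p : ℝ × (Fin 3 → ℝ)) : ℝ :=
  fderiv ℝ u p (1, 0)

/-- Spatial partial derivative `∂ᵢu` of `u : ℝ × ℝ³ → ℝ` at `p = (t,x)`. -/
noncomputable def pxDeriv (u : ℝ × (Fin 3 → ℝ) → ℝ) (i : Fin 3) (p : ℝ × (Fin 3 → ℝ)) : ℝ :=
  fderiv ℝ u p (0, Pi.single i 1)

/-- `|∇u|²`, the squared Euclidean norm of the spatial gradient of `u`. -/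
noncomputable def gradSq (u : ℝ × (Fin 3 → ℝ) → ℝ) (p : ℝ × (Fin 3 → ℝ)) : ℝ :=
  ∑ i, (pxDeriv u i p)^2

/-- `α·∇u`, the Euclidean inner product of the vector field `α` with the spatial
gradient of `u`. -/
noncomputable def gradDot (u : ℝ × (Fin 3 → ℝ) → ℝ) (α : (Fin 3 → ℝ) → (Fin 3 → ℝ))
    (p : ℝ × (Fin 3 → ℝ)) : ℝ :=
  ∑ i, α p.2 i * pxDeriv u i p

/-- Spatial partial derivative `∂ᵢ(α_j)` of a vector field `α : ℝ³ → ℝ³`. -/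
noncomputable def vecDeriv (α : (Fin 3 → ℝ) → (Fin 3 → ℝ)) (i j : Fin 3)
    (x : Fin 3 → ℝ) : ℝ :=
  fderiv ℝ (fun y => α y j) x (Pi.single i 1)

/-- Spatial divergence `div α = Σᵢ ∂ᵢαᵢ` of a vector field `α : ℝ³ → ℝ³`. -/
noncomputable def vecDiv (α : (Fin 3 → ℝ) → (Fin 3 → ℝ)) (x : Fin 3 → ℝ) : ℝ :=
  ∑ i, vecDeriv α i i x

/-- The multiplier density
`Q = (t+M)(|∇u|²/2 + u⁶/6 + (∂ₜu)²/2) + (∂ₜu)(α·∇u) + u ∂ₜu`. -/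
noncomputable def Qmult (u : ℝ × (Fin 3 → ℝ) → ℝ) (α : (Fin 3 → ℝ) → (Fin 3 → ℝ))
    (M : ℝ) (p : ℝ × (Fin 3 → ℝ)) : ℝ :=
  (p.1 + M) * (gradSq u p / 2 + (u p)^6 / 6 + (ptDeriv u p)^2 / 2)
    + ptDeriv u p * gradDot u α p + u p * ptDeriv u p

/-- The multiplier flux
`P = (|∇u|²/2 + u⁶/6 − (∂ₜu)²/2) α − ((t+M)∂ₜu + α·∇u + u) ∇u`. -/
noncomputable def Pmult (u : ℝ × (Fin 3 → ℝ) → ℝ) (α : (Fin 3 → ℝ) → (Fin 3 → ℝ))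
    (M : ℝ) (p : ℝ × (Fin 3 → ℝ)) : Fin 3 → ℝ := fun j =>
  (gradSq u p / 2 + (u p)^6 / 6 - (ptDeriv u p)^2 / 2) * α p.2 j
    - ((p.1 + M) * ptDeriv u p + gradDot u α p + u p) * pxDeriv u j p

/-- The remainder
`R = (div α − 3)(∂ₜu)²/2 + (1 − div α)|∇u|²/2 + (5 − div α) u⁶/6 + Σᵢⱼ ∂ᵢα_j ∂ᵢu ∂_j u`. -/
noncomputable def Rmult (u : ℝ × (Fin 3 → ℝ) → ℝ) (α : (Fin 3 → ℝ) → (Fin 3 → ℝ))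
    (p : ℝ × (Fin 3 → ℝ)) : ℝ :=
  (vecDiv α p.2 - 3) * (ptDeriv u p)^2 / 2
    + (1 - vecDiv α p.2) * gradSq u p / 2
    + (5 - vecDiv α p.2) * (u p)^6 / 6
    + ∑ i, ∑ j, vecDeriv α i j p.2 * pxDeriv u i p * pxDeriv u j p

/-- The derivative of `p ↦ fderiv ℝ u p v` is the second derivative of `u` with `v` plugged in. -/
theorem ContDiffAt.hasFDerivAt_fderiv_apply {E : Type*} [NormedAddCommGroup E] [NormedSpace ℝ E]
    {u : E → ℝ} {p : E} (hu : ContDiffAt ℝ 2 u p) (v : E) :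
    HasFDerivAt (fun q => fderiv ℝ u q v) ((fderiv ℝ (fderiv ℝ u) p).flip v) p := by
  have h : DifferentiableAt ℝ (fderiv ℝ u) p :=
    (hu.fderiv_right (m := 1) (by norm_num)).differentiableAt (by norm_num)
  simpa using h.hasFDerivAt.clm_apply (hasFDerivAt_const v p)

/-- The multiplier divergence identity `∂ₜQ + div P + R = 0` obtained by multiplying the
energy-critical wave equation `∂ₜ²u − Δu = −u⁵` by `u + α·∇u + (t+M)∂ₜu`. -/
theorem multiplier_divergence_identity (O : Set (Fin 3 → ℝ)) (hO : IsOpen O)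
    (u : ℝ × (Fin 3 → ℝ) → ℝ)
    (hu : ContDiffOn ℝ 2 u (Set.univ ×ˢ O))
    (α : (Fin 3 → ℝ) → (Fin 3 → ℝ))
    (hα : ContDiffOn ℝ 1 α O)
    (M : ℝ)
    (hwave : ∀ p ∈ Set.univ ×ˢ O,
      ptDeriv (ptDeriv u) p - ∑ i, pxDeriv (pxDeriv u i) i p = -(u p)^5) :
    ∀ p ∈ Set.univ ×ˢ O,
      ptDeriv (Qmult u α M) p
        + (∑ i, pxDeriv (fun q => Pmult u α M q i) i p)
        + Rmult u α p = 0 := by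
  intro p hp
  have hup : ContDiffAt ℝ 2 u p := hu.contDiffAt ((isOpen_univ.prod hO).mem_nhds hp)
  have hαp : DifferentiableAt ℝ α p.2 :=
    (hα.contDiffAt (hO.mem_nhds hp.2)).differentiableAt (by norm_num)
  have hsymm (v w : ℝ × (Fin 3 → ℝ)) :
      fderiv ℝ (fderiv ℝ u) p v w = fderiv ℝ (fderiv ℝ u) p w v :=
    hup.isSymmSndFDerivAt (by simp) v w
  have h0 : HasFDerivAt u (fderiv ℝ u p) p := (hup.differentiableAt (by norm_num)).hasFDerivAt
  have ht : HasFDerivAt (ptDeriv u) ((fderiv ℝ (fderiv ℝ u) p).flip (1, 0)) p :=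
    hup.hasFDerivAt_fderiv_apply _
  have hx (i : Fin 3) : HasFDerivAt (pxDeriv u i)
      ((fderiv ℝ (fderiv ℝ u) p).flip (0, Pi.single i 1)) p :=
    hup.hasFDerivAt_fderiv_apply _
  have ha (j : Fin 3) : HasFDerivAt (fun q : ℝ × (Fin 3 → ℝ) => α q.2 j)
      ((fderiv ℝ (fun y => α y j) p.2).comp (ContinuousLinearMap.snd ℝ ℝ (Fin 3 → ℝ))) p :=
    HasFDerivAt.comp (g := fun y => α y j) p
      (differentiableAt_pi.1 hαp j).hasFDerivAt hasFDerivAt_snd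
  have hs : HasFDerivAt (fun q : ℝ × (Fin 3 → ℝ) => q.1 + M)
      (ContinuousLinearMap.fst ℝ ℝ (Fin 3 → ℝ)) p := hasFDerivAt_fst.add_const M
  have hgs : HasFDerivAt (gradSq u) _ p :=
    HasFDerivAt.fun_sum (u := Finset.univ) fun i _ => (hx i).pow 2
  have hgd : HasFDerivAt (gradDot u α) _ p :=
    HasFDerivAt.fun_sum (u := Finset.univ) fun i _ => (ha i).mul (hx i)
  have hQ : HasFDerivAt (Qmult u α M) _ p :=
    ((hs.mul (((hgs.mul_const (2⁻¹ : ℝ)).add ((h0.pow 6).mul_const (6⁻¹ : ℝ))).add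
      ((ht.pow 2).mul_const (2⁻¹ : ℝ)))).add (ht.mul hgd)).add (h0.mul ht)
  have hP (j : Fin 3) : HasFDerivAt (fun q => Pmult u α M q j) _ p :=
    ((((hgs.mul_const (2⁻¹ : ℝ)).add ((h0.pow 6).mul_const (6⁻¹ : ℝ))).sub
      ((ht.pow 2).mul_const (2⁻¹ : ℝ))).mul (ha j)).sub
      ((((hs.mul ht).add hgd).add h0).mul (hx j))
  have hw := hwave p hp
  have eQ : ptDeriv (Qmult u α M) p = _ := congrArg (fun L => L (1, 0)) hQ.fderiv
  have eP (j : Fin 3) : pxDeriv (fun q => Pmult u α M q j) j p = _ :=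
    congrArg (fun L => L (0, Pi.single j 1)) (hP j).fderiv
  have ett : ptDeriv (ptDeriv u) p = _ := congrArg (fun L => L (1, 0)) ht.fderiv
  have exx (i : Fin 3) : pxDeriv (pxDeriv u i) i p = _ :=
    congrArg (fun L => L (0, Pi.single i 1)) (hx i).fderiv
  have et : fderiv ℝ u p (1, 0) = ptDeriv u p := rfl
  have ex (i : Fin 3) : fderiv ℝ u p (0, Pi.single i 1) = pxDeriv u i p := rfl
  have ea (i j : Fin 3) : fderiv ℝ (fun y => α y j) p.2 (Pi.single i 1) = vecDeriv α i j p.2 := rfl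
  rw [ett] at hw
  simp only [exx] at hw
  rw [eQ]
  simp only [eP]
  simp [Fin.sum_univ_three, Rmult, vecDiv, gradSq, gradDot, et, ex, ea] at hw ⊢
  rw [hsymm (0, Pi.single 0 1) (1, 0), hsymm (0, Pi.single 1 1) (1, 0),
    hsymm (0, Pi.single 2 1) (1, 0), hsymm (0, Pi.single 1 1) (0, Pi.single 0 1),
    hsymm (0, Pi.single 2 1) (0, Pi.single 0 1), hsymm (0, Pi.single 2 1) (0, Pi.single 1 1)]
  linear_combination ((p.1 + M) * ptDeriv u p + u p + (α p.2 0 * pxDeriv u 0 p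
    + α p.2 1 * pxDeriv u 1 p + α p.2 2 * pxDeriv u 2 p)) * hw
end

section
/- Let φ : [0,∞) → ℝ be continuous and nonnegative, let γ : [1,∞) → ℝ be continuous, let η ∈ (0,1), and define ψ(T) = (1/T)∫₀ᵀ φ(t) dt for T > 0. If φ(T) ≤ γ(T) + η ψ(T) for all T ≥ 1, then for every T ≥ 1 one has ψ(T) ≤ T^{η−1} ψ(1) + T^{η−1} ∫₁ᵀ γ(t) t^{−η} dt. -/
/-- Gronwall-type integral inequality: if `ψ(T) = (1/T)∫₀ᵀ φ` and
`φ(T) ≤ γ(T) + η ψ(T)` for `T ≥ 1` with `η ∈ (0,1)`, then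
`ψ(T) ≤ T^{η−1} ψ(1) + T^{η−1} ∫₁ᵀ γ(t) t^{−η} dt` for all `T ≥ 1`. -/
theorem gronwall_average_bound (φ γ ψ : ℝ → ℝ) (η : ℝ)
    (hφc : ContinuousOn φ (Set.Ici 0))
    (hφ0 : ∀ t ∈ Set.Ici (0:ℝ), 0 ≤ φ t)
    (hγc : ContinuousOn γ (Set.Ici 1))
    (hη : η ∈ Set.Ioo (0:ℝ) 1)
    (hψ : ∀ T > (0:ℝ), ψ T = (1/T) * ∫ t in (0:ℝ)..T, φ t)
    (hineq : ∀ T ≥ (1:ℝ), φ T ≤ γ T + η * ψ T) :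
    ∀ T ≥ (1:ℝ),
      ψ T ≤ T ^ (η - 1) * ψ 1 + T ^ (η - 1) * ∫ t in (1:ℝ)..T, γ t * t ^ (-η) := by
  intro T hT
  have hint : ∀ x ≥ (0 : ℝ), IntervalIntegrable φ MeasureTheory.volume 0 x := fun x hx =>
    (hφc.mono (by rw [Set.uIcc_of_le hx]; exact Set.Icc_subset_Ici_self)).intervalIntegrable
  have hderiv : ∀ x > (0 : ℝ), HasDerivAt (fun x => x ^ (-η) * ∫ t in (0 : ℝ)..x, φ t)
      (x ^ (-η) * (φ x - η * ψ x)) x := by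
    intro x hx
    have hmeas : StronglyMeasurableAtFilter φ (nhds x) MeasureTheory.volume :=
      (hφc.mono Set.Ioi_subset_Ici_self).stronglyMeasurableAtFilter isOpen_Ioi x hx
    have hF := intervalIntegral.integral_hasDerivAt_right (hint x hx.le) hmeas
      (hφc.continuousAt (Ici_mem_nhds hx))
    refine ((Real.hasDerivAt_rpow_const (p := -η) (Or.inl hx.ne')).mul hF).congr_deriv ?_
    rw [hψ x hx, Real.rpow_sub_one hx.ne']
    ring
  have hγi : MeasureTheory.IntegrableOn (fun t => γ t * t ^ (-η)) (Set.Icc 1 T) := by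
    refine ContinuousOn.integrableOn_Icc ((hγc.mono Set.Icc_subset_Ici_self).mul ?_)
    exact continuousOn_id.rpow_const fun x hx => Or.inl (zero_lt_one.trans_le hx.1).ne'
  have key := intervalIntegral.sub_le_integral_of_hasDeriv_right_of_le hT
    (fun x hx => (hderiv x (zero_lt_one.trans_le hx.1)).continuousAt.continuousWithinAt)
    (fun x hx => (hderiv x (zero_lt_one.trans hx.1)).hasDerivWithinAt) hγi
    (fun x hx => by
      rw [mul_comm]
      exact mul_le_mul_of_nonneg_right (by linarith [hineq x hx.1.le])
        (Real.rpow_nonneg (zero_lt_one.trans hx.1).le _))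
  have hT0 : 0 < T := zero_lt_one.trans_le hT
  have hψT : ψ T = T ^ (η - 1) * (T ^ (-η) * ∫ t in (0 : ℝ)..T, φ t) := by
    rw [hψ T hT0, ← mul_assoc, ← Real.rpow_add hT0, show η - 1 + -η = -1 by ring,
      Real.rpow_neg_one, one_div]
  have hψ1 : ψ 1 = ∫ t in (0 : ℝ)..1, φ t := by simp [hψ 1 one_pos]
  rw [hψT, ← mul_add, hψ1]
  refine mul_le_mul_of_nonneg_left ?_ (Real.rpow_nonneg hT0.le _)
  rw [Real.one_rpow, one_mul] at key
  linarith
end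

section
/- Let φ : [0,∞) → ℝ be continuous and nonnegative, let γ : [1,∞) → ℝ be continuous, nonnegative and bounded, let η ∈ (0,1), and define ψ(T) = (1/T)∫₀ᵀ φ(t) dt for T > 0. Suppose φ(T) ≤ γ(T) + η ψ(T) for all T ≥ 1, and suppose δ ≥ 0 satisfies limsup_{t→∞} γ(t) ≤ δ. Then limsup_{T→∞} ψ(T) ≤ δ/(1−η). In particular, if γ(t) → 0 as t → ∞, then ψ(T) → 0 as T → ∞. -/
/-- The primitive of a function continuous on `[0, ∞)` is differentiable on `(0, ∞)`. -/
theorem hasDerivAt_integral_of_continuousOn_Ici {φ : ℝ → ℝ}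
    (hφ : ContinuousOn φ (Set.Ici 0)) {x : ℝ} (hx : 0 < x) :
    HasDerivAt (fun T => ∫ t in (0:ℝ)..T, φ t) (φ x) x := by
  apply intervalIntegral.integral_hasDerivAt_right
  · apply ContinuousOn.intervalIntegrable
    rw [Set.uIcc_of_le hx.le]
    exact hφ.mono Set.Icc_subset_Ici_self
  · exact (hφ.mono Set.Ioi_subset_Ici_self).stronglyMeasurableAtFilter isOpen_Ioi x hx
  · exact hφ.continuousAt (Ici_mem_nhds hx)

/-- If `F' ≤ d + η F / T` on `[a, ∞)`, then `T ^ (-η) * F T - d / (1 - η) * T ^ (1 - η)` is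
nonincreasing there. -/
theorem antitoneOn_rpow_mul_sub_of_deriv_le {F f : ℝ → ℝ} {η d a : ℝ} (ha : 0 < a) (hη : η < 1)
    (hF : ∀ x ≥ a, HasDerivAt F (f x) x) (hf : ∀ x ≥ a, f x ≤ d + η * (F x / x)) :
    AntitoneOn (fun T => T ^ (-η) * F T - d / (1 - η) * T ^ (1 - η)) (Set.Ici a) := by
  have hG : ∀ x ≥ a, HasDerivAt (fun T => T ^ (-η) * F T - d / (1 - η) * T ^ (1 - η))
      (x ^ (-η) * (f x - d - η * (F x / x))) x := by
    intro x hxa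
    have hx : 0 < x := ha.trans_le hxa
    have h1 := (Real.hasDerivAt_rpow_const (p := -η) (Or.inl hx.ne')).mul (hF x hxa)
    have h2 := (Real.hasDerivAt_rpow_const (p := 1 - η) (Or.inl hx.ne')).const_mul (d / (1 - η))
    refine (h1.sub h2).congr_deriv ?_
    have hη' : 1 - η ≠ 0 := by linarith
    rw [show 1 - η - 1 = -η by ring, Real.rpow_sub_one hx.ne']
    field_simp
    ring
  refine antitoneOn_of_deriv_nonpos (convex_Ici a)
    (fun x hx => (hG x hx).continuousAt.continuousWithinAt) ?_ ?_
  · intro x hx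
    exact (hG x (interior_subset hx)).differentiableAt.differentiableWithinAt
  · intro x hx
    have hxa : a ≤ x := interior_subset hx
    rw [(hG x hxa).deriv]
    exact mul_nonpos_of_nonneg_of_nonpos (Real.rpow_nonneg (ha.le.trans hxa) _)
      (by linarith [hf x hxa])

/-- If `F' ≤ d + η F / T` on `[a, ∞)` with `η < 1`, then `F T / T` is eventually below every
number exceeding `d / (1 - η)`. -/
theorem eventually_div_lt_of_deriv_le {F f : ℝ → ℝ} {η d a b : ℝ} (ha : 0 < a) (hη : η < 1)
    (hF : ∀ x ≥ a, HasDerivAt F (f x) x) (hf : ∀ x ≥ a, f x ≤ d + η * (F x / x))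
    (hb : d / (1 - η) < b) : ∀ᶠ T in Filter.atTop, F T / T < b := by
  have hanti := antitoneOn_rpow_mul_sub_of_deriv_le ha hη hF hf
  set C := a ^ (-η) * F a - d / (1 - η) * a ^ (1 - η) with hC
  have hlim : Filter.Tendsto (fun T : ℝ => d / (1 - η) + C * T ^ (-(1 - η))) Filter.atTop
      (nhds (d / (1 - η))) := by
    simpa using ((tendsto_rpow_neg_atTop (sub_pos.2 hη)).const_mul C).const_add (d / (1 - η))
  filter_upwards [hlim.eventually_lt_const hb, Filter.eventually_ge_atTop a] with T hT haT
  refine lt_of_le_of_lt ?_ hT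
  have hT0 : 0 < T := ha.trans_le haT
  have hle : T ^ (-η) * F T - d / (1 - η) * T ^ (1 - η) ≤ C := hanti Set.self_mem_Ici haT haT
  have hmul := mul_le_mul_of_nonneg_right hle (Real.rpow_nonneg hT0.le (-(1 - η)))
  have h1 : T ^ (1 - η) * T ^ (-(1 - η)) = 1 := by
    rw [← Real.rpow_add hT0]; simp
  have h2 : T ^ (-η) * T ^ (-(1 - η)) = T⁻¹ := by
    rw [← Real.rpow_add hT0, ← Real.rpow_neg_one]; congr 1; ring
  have h3 : (T ^ (-η) * F T - d / (1 - η) * T ^ (1 - η)) * T ^ (-(1 - η))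
      = F T / T - d / (1 - η) := by
    rw [div_eq_mul_inv (F T)]
    linear_combination F T * h2 - d / (1 - η) * h1
  linarith

/-- Gronwall-type decay of time averages: if `ψ(T) = (1/T)∫₀ᵀ φ`,
`φ(T) ≤ γ(T) + η ψ(T)` for `T ≥ 1` with `η ∈ (0,1)`, `γ` nonnegative and bounded with
`limsup_{t→∞} γ(t) ≤ δ`, then `limsup_{T→∞} ψ(T) ≤ δ/(1−η)`; in particular if
`γ(t) → 0` then `ψ(T) → 0`. -/
theorem gronwall_average_limsup (φ γ ψ : ℝ → ℝ) (η δ : ℝ)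
    (hφc : ContinuousOn φ (Set.Ici 0))
    (hφ0 : ∀ t ∈ Set.Ici (0:ℝ), 0 ≤ φ t)
    (hγc : ContinuousOn γ (Set.Ici 1))
    (hγ0 : ∀ t ∈ Set.Ici (1:ℝ), 0 ≤ γ t)
    (hγb : ∃ C : ℝ, ∀ t ∈ Set.Ici (1:ℝ), γ t ≤ C)
    (hη : η ∈ Set.Ioo (0:ℝ) 1)
    (hψ : ∀ T > (0:ℝ), ψ T = (1/T) * ∫ t in (0:ℝ)..T, φ t)
    (hineq : ∀ T ≥ (1:ℝ), φ T ≤ γ T + η * ψ T)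
    (hδ : 0 ≤ δ)
    (hγlimsup : Filter.limsup γ Filter.atTop ≤ δ) :
    Filter.limsup ψ Filter.atTop ≤ δ / (1 - η) ∧
      (Filter.Tendsto γ Filter.atTop (nhds 0) →
        Filter.Tendsto ψ Filter.atTop (nhds 0)) := by
  have hη1 : 0 < 1 - η := sub_pos.2 hη.2
  have hψF : ∀ T > (0:ℝ), ψ T = (∫ t in (0:ℝ)..T, φ t) / T := fun T hT => by
    rw [hψ T hT]; ring
  have hψ0 : ∀ᶠ T in Filter.atTop, 0 ≤ ψ T := by
    filter_upwards [Filter.eventually_gt_atTop 0] with T hT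
    rw [hψF T hT]
    exact div_nonneg (intervalIntegral.integral_nonneg hT.le fun t ht => hφ0 t ht.1) hT.le
  have key : ∀ c : ℝ, (∀ e > c, ∀ᶠ t in Filter.atTop, γ t < e) →
      ∀ b > c / (1 - η), ∀ᶠ T in Filter.atTop, ψ T < b := by
    intro c hc b hb
    obtain ⟨e, hce, heb⟩ := exists_between ((div_lt_iff₀ hη1).1 hb)
    obtain ⟨a, ha⟩ := Filter.eventually_atTop.1 (hc e hce)
    have hpos : 0 < max a 1 := lt_max_of_lt_right one_pos
    have hlt := eventually_div_lt_of_deriv_le hpos hη.2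
      (fun x hx => hasDerivAt_integral_of_continuousOn_Ici hφc (hpos.trans_le hx))
      (fun x hx => by
        rw [← hψF x (hpos.trans_le hx)]
        linarith [hineq x ((le_max_right _ _).trans hx), ha x ((le_max_left _ _).trans hx)])
      ((div_lt_iff₀ hη1).2 heb)
    filter_upwards [hlt, Filter.eventually_gt_atTop 0] with T hT hT0
    rwa [hψF T hT0]
  refine ⟨le_of_forall_gt_imp_ge_of_dense fun b hb => ?_, fun h => ?_⟩
  · obtain ⟨C, hC⟩ := hγb
    have hbdd : Filter.IsBoundedUnder (· ≤ ·) Filter.atTop γ :=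
      ⟨C, Filter.eventually_map.2 ((Filter.eventually_ge_atTop 1).mono hC)⟩
    have hψcobdd : Filter.IsCoboundedUnder (· ≤ ·) Filter.atTop ψ :=
      Filter.IsBoundedUnder.isCoboundedUnder_le ⟨0, Filter.eventually_map.2 hψ0⟩
    exact Filter.limsup_le_of_le hψcobdd ((key δ (fun e he =>
      Filter.eventually_lt_of_limsup_lt (hγlimsup.trans_lt he) hbdd) b hb).mono fun _ => le_of_lt)
  · refine tendsto_order.2 ⟨fun b hb => hψ0.mono fun T hT => hb.trans_le hT, fun b hb => ?_⟩
    exact key 0 (fun e he => h.eventually_lt_const he) b (by simpa using hb)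
end

section
/- Let a > 0 and K > 0 satisfy K(2a)⁴ < a, let b ≤ c be real numbers, and let f : [b,c] → ℝ be continuous and nonnegative with f(b) ≤ a. If f(S) ≤ a + K f(S)⁴ for every S ∈ [b,c], then f(S) ≤ 2a for every S ∈ [b,c]. -/
/-- The abstract continuity (bootstrap) argument used in the proof of scattering:
if a continuous nonnegative `f` on `[b,c]` satisfies `f b ≤ a` and the a-priori
estimate `f S ≤ a + K f(S)⁴` with `K (2a)⁴ < a`, then `f ≤ 2a` on `[b,c]`. -/
theorem bootstrap_continuity (a K : ℝ) (ha : 0 < a) (hK : 0 < K)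
    (hKa : K * (2*a)^4 < a) (b c : ℝ) (hbc : b ≤ c) (f : ℝ → ℝ)
    (hf : ContinuousOn f (Set.Icc b c))
    (hf0 : ∀ s ∈ Set.Icc b c, 0 ≤ f s)
    (hfb : f b ≤ a)
    (hboot : ∀ S ∈ Set.Icc b c, f S ≤ a + K * (f S)^4) :
    ∀ S ∈ Set.Icc b c, f S ≤ 2 * a := by
  intro S hS
  by_contra! hlt
  obtain ⟨t, ht, hft⟩ := intermediate_value_Icc hS.1
    (hf.mono (Set.Icc_subset_Icc_right hS.2)) ⟨by linarith, hlt.le⟩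
  have h := hboot t ⟨ht.1, ht.2.trans hS.2⟩
  rw [hft] at h
  linarith
end
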